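/- Let λ > 0, k' ∈ ℕ with k' ≥ 1, μ ∈ [k'−1, k'), k ∈ ℕ, n ∈ ℕ with n ≥ k, and x > 0. Then the left tempered fractional derivative of order μ+k of the generalized Laguerre function 𝓛_n^{(−μ,λ)} satisfies e^{−λx} · (the (k'+k)-th iterated derivative at x of y ↦ (1/Γ(k'−μ)) ∫₀^y (y−t)^{k'−μ−1} t^μ L_n^{(μ)}(2λt) dt) = (−2λ)^k · (Γ(n+1+μ)/Γ(n+1)) · L_{n−k}^{(k)}(2λx) · e^{−λx}. -/

import Mathlib

/-- The generalized Laguerre polynomial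
L_n^{(α)}(x) = ∑_{j=0}^n (−1)^j (Γ(n+α+1)/(Γ(j+α+1)Γ(n−j+1))) x^j / j!. -/
noncomputable def lagL (α : ℝ) (n : ℕ) (x : ℝ) : ℝ :=
  ∑ j ∈ Finset.range (n + 1),
    (-1 : ℝ) ^ j *
      (Real.Gamma ((n : ℝ) + α + 1) /
        (Real.Gamma ((j : ℝ) + α + 1) * Real.Gamma (((n - j : ℕ) : ℝ) + 1))) *
      x ^ j / (Nat.factorial j : ℝ)

/-- The beta integral over `[0, a]`, in real form. -/
theorem integral_sub_rpow_mul_rpow {s t a : ℝ} (hs : 0 < s) (ht : 0 < t) (ha : 0 < a) :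
    ∫ x in (0 : ℝ)..a, (a - x) ^ (s - 1) * x ^ (t - 1) =
      a ^ (s + t - 1) * (Real.Gamma s * Real.Gamma t / Real.Gamma (s + t)) := by
  have hbeta := Complex.betaIntegral_scaled (t : ℂ) (s : ℂ) ha
  rw [Complex.betaIntegral_eq_Gamma_mul_div _ _ (by simpa) (by simpa)] at hbeta
  have hint : ∫ x in (0 : ℝ)..a, (x : ℂ) ^ ((t : ℂ) - 1) * ((a : ℂ) - x) ^ ((s : ℂ) - 1) =
      ((∫ x in (0 : ℝ)..a, (a - x) ^ (s - 1) * x ^ (t - 1) : ℝ) : ℂ) := by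
    rw [← intervalIntegral.integral_ofReal]
    refine intervalIntegral.integral_congr fun x hx => ?_
    rw [Set.uIcc_of_le ha.le] at hx
    have hax : 0 ≤ a - x := sub_nonneg.2 hx.2
    simp only [Complex.ofReal_mul, Complex.ofReal_cpow hx.1, Complex.ofReal_cpow hax]
    push_cast
    ring
  rw [hint] at hbeta
  apply Complex.ofReal_injective
  rw [hbeta]
  push_cast [Complex.ofReal_cpow ha.le, ← Complex.Gamma_ofReal]
  rw [add_comm (t : ℂ) s, mul_comm (Complex.Gamma (t : ℂ))]

/-- The Riemann–Liouville integral of order `s` of `t ^ mu * L_n^{(mu)}(c t)`. -/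
theorem integral_sub_rpow_mul_rpow_mul_lagL {s mu : ℝ} (hs : 0 < s) (hmu : 0 ≤ mu) (n : ℕ)
    (c : ℝ) {y : ℝ} (hy : 0 < y) :
    (1 / Real.Gamma s) *
        ∫ t in (0 : ℝ)..y, (y - t) ^ (s - 1) * (t ^ mu * lagL mu n (c * t)) =
      ∑ j ∈ Finset.range (n + 1),
        (-c) ^ j * Real.Gamma (n + mu + 1) /
          (Nat.factorial (n - j) * Nat.factorial j * Real.Gamma (s + mu + j + 1)) *
          y ^ (s + mu + j) := by
  have hker : IntervalIntegrable (fun t : ℝ => (y - t) ^ (s - 1)) MeasureTheory.volume 0 y := by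
    have h := (intervalIntegral.intervalIntegrable_rpow' (a := 0) (b := y)
      (show -1 < s - 1 by linarith)).comp_sub_left y
    simpa using h.symm
  have hexpand : ∀ t ∈ Set.uIcc 0 y,
      (y - t) ^ (s - 1) * (t ^ mu * lagL mu n (c * t)) =
        ∑ j ∈ Finset.range (n + 1),
          (-c) ^ j * (Real.Gamma (n + mu + 1) /
            (Real.Gamma (j + mu + 1) * Nat.factorial (n - j))) / Nat.factorial j *
            ((y - t) ^ (s - 1) * t ^ ((mu + j + 1) - 1)) := by
    intro t ht
    rw [Set.uIcc_of_le hy.le] at ht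
    simp only [lagL, Finset.mul_sum, Real.Gamma_nat_eq_factorial]
    refine Finset.sum_congr rfl fun j _ => ?_
    rw [add_sub_cancel_right, Real.rpow_add_of_nonneg ht.1 hmu (Nat.cast_nonneg j),
      Real.rpow_natCast, neg_pow c, mul_pow]
    ring
  rw [intervalIntegral.integral_congr hexpand, intervalIntegral.integral_finsetSum,
    Finset.mul_sum]
  · refine Finset.sum_congr rfl fun j _ => ?_
    have hj : 0 < mu + j + 1 := by positivity
    rw [intervalIntegral.integral_const_mul, integral_sub_rpow_mul_rpow hs hj hy,
      show s + (mu + j + 1) - 1 = s + mu + j by ring,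
      show s + (mu + j + 1) = s + mu + j + 1 by ring, show (j : ℝ) + mu + 1 = mu + j + 1 by ring]
    have h1 := (Real.Gamma_pos_of_pos hs).ne'
    have h2 := (Real.Gamma_pos_of_pos hj).ne'
    have h3 := (Real.Gamma_pos_of_pos (show 0 < s + mu + j + 1 by positivity)).ne'
    field_simp
  · intro j _
    refine (hker.mul_continuousOn ?_).const_mul _
    exact continuousOn_id.rpow_const fun _ _ => Or.inr (by
      have := Nat.cast_nonneg (α := ℝ) j
      linarith)

/-- for λ > 0, k' ≥ 1, μ ∈ [k'−1,k'), k ∈ ℕ, n ≥ k, x > 0, the left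
tempered fractional derivative of order μ+k of 𝓛_n^{(−μ,λ)}(t) = t^μ e^{−λt} L_n^{(μ)}(2λt):
e^{−λx} (d/dx)^{k'+k} [(1/Γ(k'−μ)) ∫₀^y (y−t)^{k'−μ−1} t^μ L_n^{(μ)}(2λt) dt]|_{y=x}
  = (−2λ)^k (Γ(n+1+μ)/Γ(n+1)) L_{n−k}^{(k)}(2λx) e^{−λx}. -/
theorem temperedDerivL_GLF_highOrder (lam : ℝ) (hlam : 0 < lam) (k' : ℕ) (hk' : 1 ≤ k')
    (mu : ℝ) (hmu1 : (k' : ℝ) - 1 ≤ mu) (hmu2 : mu < k') (k n : ℕ) (hn : k ≤ n)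
    (x : ℝ) (hx : 0 < x) :
    Real.exp (-(lam * x)) *
        iteratedDeriv (k' + k)
          (fun y => (1 / Real.Gamma ((k' : ℝ) - mu)) *
            ∫ t in (0 : ℝ)..y, (y - t) ^ ((k' : ℝ) - mu - 1) * (t ^ mu * lagL mu n (2 * lam * t))) x
      = (-(2 * lam)) ^ k * (Real.Gamma ((n : ℝ) + 1 + mu) / Real.Gamma ((n : ℝ) + 1)) *
          lagL (k : ℝ) (n - k) (2 * lam * x) * Real.exp (-(lam * x)) := by
  have hmu : 0 ≤ mu := by
    have : (1 : ℝ) ≤ k' := by exact_mod_cast hk'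
    linarith
  have hev : (fun y => (1 / Real.Gamma ((k' : ℝ) - mu)) *
      ∫ t in (0 : ℝ)..y, (y - t) ^ ((k' : ℝ) - mu - 1) * (t ^ mu * lagL mu n (2 * lam * t)))
      =ᶠ[nhds x] fun y => ∑ j ∈ Finset.range (n + 1),
        (-(2 * lam)) ^ j * Real.Gamma (n + mu + 1) /
          (Nat.factorial (n - j) * Nat.factorial j * Nat.factorial (k' + j)) * y ^ (k' + j) := by
    filter_upwards [lt_mem_nhds hx] with y hy
    rw [integral_sub_rpow_mul_rpow_mul_lagL (sub_pos.2 hmu2) hmu n _ hy]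
    refine Finset.sum_congr rfl fun j _ => ?_
    rw [sub_add_cancel, ← Nat.cast_add, Real.Gamma_nat_eq_factorial, Real.rpow_natCast]
  rw [hev.iteratedDeriv_eq, iteratedDeriv_fun_sum fun j _ => by fun_prop,
    mul_comm (Real.exp _)]
  congr 1
  simp only [iteratedDeriv_const_mul_field, iteratedDeriv_pow]
  rw [show n + 1 = k + (n - k + 1) by lia, Finset.sum_range_add, Finset.sum_eq_zero, zero_add,
    lagL, Finset.mul_sum]
  · refine Finset.sum_congr rfl fun i hi => ?_
    have hdesc : ((Nat.factorial i : ℝ)) * (k' + (k + i)).descFactorial (k' + k) =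
        Nat.factorial (k' + (k + i)) := by
      have h := Nat.factorial_mul_descFactorial (show k' + k ≤ k' + (k + i) by lia)
      rw [show k' + (k + i) - (k' + k) = i by lia] at h
      exact_mod_cast h
    rw [← hdesc, show k' + (k + i) - (k' + k) = i by lia, show n - (k + i) = n - k - i by lia,
      ← Nat.cast_add (n - k), ← Nat.cast_add i, Nat.sub_add_cancel hn]
    simp only [Real.Gamma_nat_eq_factorial]
    rw [add_comm i k, show (n : ℝ) + 1 + mu = n + mu + 1 by ring, pow_add, mul_pow,
      neg_pow (2 * lam) i]
    have hd : ((k' + (k + i)).descFactorial (k' + k) : ℝ) ≠ 0 := by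
      rw [Nat.cast_ne_zero, Ne, Nat.descFactorial_eq_zero_iff_lt]
      lia
    field_simp
  · intro j hj
    rw [Nat.descFactorial_eq_zero_iff_lt.2 (by simpa using hj)]
    simp
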